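/- Range-based safe pruning (RSP, Theorem 7): let λ₀ > 0, let α₀* be a maximizer of D_{λ₀} over the nonnegative orthant, and let α₀ ≥ 0 satisfy ‖α₀ − α₀*‖₂ ≤ ε. For a feature index k define a := Σ_{j : σ_j = +1} (α₀)_j·max(x_{a_j,k}, x_{b_j,k})² and b := sqrt(Σ_{j=1}^N max(x_{a_j,k}, x_{b_j,k})⁴), and set λ′_a := λ₀·(2εb + ‖α₀‖₂·b + a) / (2λ₀ + ‖α₀‖₂·b − a). Then for every λ with λ′_a ≤ λ ≤ λ₀, every maximizer α_λ* of D_λ over the nonnegative orthant, and every descendant k′ of k, (m_λ(α_λ*))_{k′} = 0. -/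

import Mathlib

open Finset

/-- The matrix `C` with entries `C_{k,j} = σ_j · (x_{a_j,k} − x_{b_j,k})²`. -/
def pairC {n p N : ℕ} (x : Fin n → Fin p → ℝ) (sgn : Fin N → ℝ)
    (a b : Fin N → Fin n) : Matrix (Fin p) (Fin N) ℝ :=
  fun k j => sgn j * (x (a j) k - x (b j) k) ^ 2

/-- The vector `m_λ(α)` with `(m_λ(α))_k = (1/(λη)) · max((Cα)_k − λ, 0)`. -/
noncomputable def mLam {p N : ℕ} (C : Matrix (Fin p) (Fin N) ℝ) (lam eta : ℝ)
    (α : Fin N → ℝ) : Fin p → ℝ :=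
  fun k => (1 / (lam * eta)) * max ((∑ j, C k j * α j) - lam) 0

/-- The dual objective `D_λ(α)`. -/
noncomputable def dualObj {p N : ℕ} (C : Matrix (Fin p) (Fin N) ℝ) (t : Fin N → ℝ)
    (lam eta : ℝ) (α : Fin N → ℝ) : ℝ :=
  -(1 / 4) * (∑ j, α j ^ 2) + (∑ j, t j * α j)
    - lam * eta / 2 * ∑ k, mLam C lam eta α k ^ 2

/-- First-order optimality condition for minimizing a convex function plus a quadratic. -/
lemma ConvexOn.variational_inequality_of_isMinOn_add_sq {E : Type*} [NormedAddCommGroup E]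
    [InnerProductSpace ℝ E] {S : Set E} {G : E → ℝ} (hG : ConvexOn ℝ S G) {c : ℝ} (hc : 0 ≤ c)
    {u v : E} (hu : u ∈ S) (hv : v ∈ S)
    (hmin : IsMinOn (fun w => G w + c / 2 * ‖w‖ ^ 2) S u) :
    0 ≤ G v - G u + c * inner ℝ u (v - u) := by
  have key : ∀ s : ℝ, 0 < s → s ≤ 1 →
      0 ≤ (G v - G u + c * inner ℝ u (v - u)) + s * (c / 2 * ‖v - u‖ ^ 2) := by
    intro s hs hs1
    have hw : (1 - s) • u + s • v = u + s • (v - u) := by module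
    have hmem : u + s • (v - u) ∈ S := hw ▸ hG.1 hu hv (by linarith) hs.le (by ring)
    have hconv := hG.2 hu hv (sub_nonneg.2 hs1) hs.le (by ring)
    rw [hw, smul_eq_mul, smul_eq_mul] at hconv
    have hle := isMinOn_iff.1 hmin _ hmem
    have hnorm : ‖u + s • (v - u)‖ ^ 2
        = ‖u‖ ^ 2 + 2 * s * inner ℝ u (v - u) + s ^ 2 * ‖v - u‖ ^ 2 := by
      rw [norm_add_sq_real, inner_smul_right, norm_smul, mul_pow, Real.norm_eq_abs, sq_abs]
      ring
    simp only [hnorm] at hle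
    refine le_of_mul_le_mul_left ?_ hs
    linarith
  by_contra! hneg
  set A := G v - G u + c * inner ℝ u (v - u)
  set B := c / 2 * ‖v - u‖ ^ 2
  have hB : 0 ≤ B := by positivity
  have hBA : 0 < B - A := by linarith
  have h := key (-A / (B - A)) (div_pos (by linarith) hBA) ((div_le_one hBA).2 (by linarith))
  have h' : A + -A / (B - A) * B = -(A ^ 2 / (B - A)) := by field_simp; ring
  have : 0 < A ^ 2 / (B - A) := div_pos (sq_pos_of_neg hneg) hBA
  linarith

/-- The sphere bound implied by an obtuse-angle condition between rescaled solutions. -/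
lemma norm_sub_smul_le_of_inner_nonneg {E : Type*} [NormedAddCommGroup E]
    [InnerProductSpace ℝ E] {u v : E} {l l₀ : ℝ} (hl : 0 < l) (hll : l ≤ l₀)
    (h : 0 ≤ inner ℝ (v - u) (l₀⁻¹ • u - l⁻¹ • v)) :
    ‖v - ((l₀ + l) / (2 * l₀)) • u‖ ≤ (l₀ - l) / (2 * l₀) * ‖u‖ := by
  have hl₀ : 0 < l₀ := hl.trans_le hll
  refine le_of_sq_le_sq ?_ (mul_nonneg (div_nonneg (by linarith) (by linarith)) (norm_nonneg _))
  have h1 : 0 ≤ l * inner ℝ (v - u) (l₀⁻¹ • u - l⁻¹ • v) := mul_nonneg hl.le h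
  have h2 : l * inner ℝ (v - u) (l₀⁻¹ • u - l⁻¹ • v)
      = ((l₀ + l) / l₀) * inner ℝ v u - l / l₀ * ‖u‖ ^ 2 - ‖v‖ ^ 2 := by
    simp only [inner_sub_left, inner_sub_right, inner_smul_right, real_inner_self_eq_norm_sq,
      real_inner_comm v u]
    field_simp
    ring
  rw [norm_sub_sq_real, inner_smul_right, norm_smul, mul_pow, mul_pow, Real.norm_eq_abs, sq_abs]
  have h3 : ((l₀ - l) / (2 * l₀)) ^ 2 = ((l₀ + l) / (2 * l₀)) ^ 2 - l / l₀ := by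
    field_simp; ring
  have h4 : 2 * ((l₀ + l) / (2 * l₀) * inner ℝ v u) = ((l₀ + l) / l₀) * inner ℝ v u := by
    field_simp
  rw [h3, h4]
  linarith

/-- The part of the rescaled negative dual objective that does not depend on `λ`. -/
noncomputable def rescaledLoss {p N : ℕ} (C : Matrix (Fin p) (Fin N) ℝ) (t : Fin N → ℝ)
    (eta : ℝ) (w : EuclideanSpace ℝ (Fin N)) : ℝ :=
  -(∑ j, t j * w j) + 1 / (2 * eta) * ∑ k, max ((∑ j, C k j * w j) - 1) 0 ^ 2

lemma convexOn_rescaledLoss {p N : ℕ} (C : Matrix (Fin p) (Fin N) ℝ) (t : Fin N → ℝ)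
    {eta : ℝ} (heta : 0 < eta) {S : Set (EuclideanSpace ℝ (Fin N))} (hS : Convex ℝ S) :
    ConvexOn ℝ S (rescaledLoss C t eta) := by
  have hlin : ∀ (c : Fin N → ℝ) (u v : EuclideanSpace ℝ (Fin N)) (r s : ℝ),
      ∑ j, c j * (r • u + s • v) j = r * ∑ j, c j * u j + s * ∑ j, c j * v j := by
    intro c u v r s
    simp only [PiLp.add_apply, PiLp.smul_apply, smul_eq_mul, mul_sum, ← sum_add_distrib]
    exact sum_congr rfl fun j _ => by ring
  have hpos : ∀ k, ConvexOn ℝ S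
      (fun w : EuclideanSpace ℝ (Fin N) => max ((∑ j, C k j * w j) - 1) 0 ^ 2) := by
    intro k
    refine ConvexOn.pow (f := fun w : EuclideanSpace ℝ (Fin N) => max ((∑ j, C k j * w j) - 1) 0)
      (ConvexOn.sup ⟨hS, ?_⟩ (convexOn_const 0 hS)) (fun _ _ => le_max_right _ _) 2
    intro u _ v _ r s _ _ hrs
    simp only [hlin, smul_eq_mul]
    linarith
  refine ⟨hS, fun u hu v hv r s hr hs hrs => ?_⟩
  have hsum := sum_le_sum fun k (_ : k ∈ univ) => (hpos k).2 hu hv hr hs hrs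
  simp only [smul_eq_mul, sum_add_distrib, ← mul_sum] at hsum
  have := mul_le_mul_of_nonneg_left hsum (by positivity : 0 ≤ 1 / (2 * eta))
  simp only [rescaledLoss, hlin, smul_eq_mul]
  simp only [hlin] at this
  linarith

lemma dualObj_smul_eq {p N : ℕ} (C : Matrix (Fin p) (Fin N) ℝ) (t : Fin N → ℝ)
    {lam eta : ℝ} (hlam : 0 < lam) (heta : 0 < eta) (w : EuclideanSpace ℝ (Fin N)) :
    dualObj C t lam eta (fun j => lam * w j)
      = -lam * (rescaledLoss C t eta w + lam / 2 / 2 * ‖w‖ ^ 2) := by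
  have h1 : ∀ c : Fin N → ℝ, ∑ j, c j * (lam * w j) = lam * ∑ j, c j * w j := by
    intro c
    rw [mul_sum]
    exact sum_congr rfl fun j _ => by ring
  have h2 : ∀ k, max (lam * (∑ j, C k j * w j) - lam) 0
      = lam * max ((∑ j, C k j * w j) - 1) 0 := by
    intro k
    rw [mul_max_of_nonneg _ _ hlam.le, mul_zero, mul_sub, mul_one]
  simp only [dualObj, mLam, rescaledLoss, h1, h2, mul_pow, ← mul_sum, EuclideanSpace.norm_sq_eq,
    Real.norm_eq_abs, sq_abs]
  field_simp
  ring

/-- The nonnegative orthant of Euclidean space. -/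
def nonnegOrthant (N : ℕ) : Set (EuclideanSpace ℝ (Fin N)) := {w | ∀ j, 0 ≤ w j}

lemma convex_nonnegOrthant (N : ℕ) : Convex ℝ (nonnegOrthant N) := by
  intro u hu v hv r s hr hs _ j
  exact add_nonneg (mul_nonneg hr (hu j)) (mul_nonneg hs (hv j))

lemma isMinOn_rescaledLoss_of_isMaxOn_dualObj {p N : ℕ} {C : Matrix (Fin p) (Fin N) ℝ}
    {t : Fin N → ℝ} {lam eta : ℝ} (hlam : 0 < lam) (heta : 0 < eta)
    {α : EuclideanSpace ℝ (Fin N)}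
    (h : IsMaxOn (dualObj C t lam eta) {β | ∀ j, 0 ≤ β j} α) :
    IsMinOn (fun w => rescaledLoss C t eta w + lam / 2 / 2 * ‖w‖ ^ 2) (nonnegOrthant N)
      (lam⁻¹ • α) := by
  refine isMinOn_iff.2 fun w hw => ?_
  have hle := isMaxOn_iff.1 h (fun j => lam * w j) fun j => mul_nonneg hlam.le (hw j)
  have hα : (fun j => lam * (lam⁻¹ • α) j) = α := by
    ext j
    simp [hlam.ne']
  rw [← hα, dualObj_smul_eq C t hlam heta, dualObj_smul_eq C t hlam heta] at hle
  exact le_of_mul_le_mul_left (by linarith) hlam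

/-- Dual optima for two regularization parameters are related by a sphere bound. -/
lemma norm_sub_smul_le_of_isMaxOn_dualObj {p N : ℕ} {C : Matrix (Fin p) (Fin N) ℝ}
    {t : Fin N → ℝ} {lam lam0 eta : ℝ} (hlam : 0 < lam) (hle : lam ≤ lam0) (heta : 0 < eta)
    {α α0 : EuclideanSpace ℝ (Fin N)} (hα : ∀ j, 0 ≤ α j) (hα0 : ∀ j, 0 ≤ α0 j)
    (hmax : IsMaxOn (dualObj C t lam eta) {β | ∀ j, 0 ≤ β j} α)
    (hmax0 : IsMaxOn (dualObj C t lam0 eta) {β | ∀ j, 0 ≤ β j} α0) :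
    ‖α - ((lam0 + lam) / (2 * lam0)) • α0‖ ≤ (lam0 - lam) / (2 * lam0) * ‖α0‖ := by
  have hlam0 : 0 < lam0 := hlam.trans_le hle
  have hG := convexOn_rescaledLoss C t heta (convex_nonnegOrthant N)
  have hmem : lam⁻¹ • α ∈ nonnegOrthant N := fun j => mul_nonneg (inv_pos.2 hlam).le (hα j)
  have hmem0 : lam0⁻¹ • α0 ∈ nonnegOrthant N := fun j => mul_nonneg (inv_pos.2 hlam0).le (hα0 j)
  have h1 := hG.variational_inequality_of_isMinOn_add_sq (c := lam / 2) (by positivity) hmem hmem0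
    (isMinOn_rescaledLoss_of_isMaxOn_dualObj hlam heta hmax)
  have h0 := hG.variational_inequality_of_isMinOn_add_sq (c := lam0 / 2) (by positivity) hmem0 hmem
    (isMinOn_rescaledLoss_of_isMaxOn_dualObj hlam0 heta hmax0)
  refine norm_sub_smul_le_of_inner_nonneg hlam hle ?_
  rw [inner_smul_left, RCLike.conj_to_real, div_mul_eq_mul_div, mul_inv_cancel_left₀ hlam.ne'] at h1
  rw [inner_smul_left, RCLike.conj_to_real, div_mul_eq_mul_div, mul_inv_cancel_left₀ hlam0.ne',
    ← neg_sub (lam0⁻¹ • α0), inner_neg_right] at h0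
  rw [inner_sub_left]
  linarith

/-- `∑ q α` is controlled by `∑ q α₀` and the distance from `α` to a multiple of `α₀`. -/
lemma sum_mul_le_of_norm_sub_smul_le {N : ℕ} (q : Fin N → ℝ) (α α0 : EuclideanSpace ℝ (Fin N))
    {c R : ℝ} (h : ‖α - c • α0‖ ≤ R) :
    ∑ j, q j * α j ≤ c * ∑ j, q j * α0 j + R * Real.sqrt (∑ j, q j ^ 2) := by
  have h1 := real_inner_le_norm (WithLp.toLp 2 q) (α - c • α0)
  have h2 : ‖WithLp.toLp 2 q‖ = Real.sqrt (∑ j, q j ^ 2) := by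
    simp [EuclideanSpace.norm_eq]
  have h3 : ∀ β : EuclideanSpace ℝ (Fin N), inner ℝ (WithLp.toLp 2 q) β = ∑ j, q j * β j := by
    intro β
    simp [PiLp.inner_apply, mul_comm]
  rw [inner_sub_right, inner_smul_right, h3, h3, h2] at h1
  nlinarith [mul_le_mul_of_nonneg_left h (Real.sqrt_nonneg (∑ j, q j ^ 2))]

lemma sq_sub_le_sq_max {r s r' s' : ℝ} (hr : 0 ≤ r) (hs : 0 ≤ s) (hr' : r ≤ r') (hs' : s ≤ s') :
    (r - s) ^ 2 ≤ max r' s' ^ 2 := by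
  refine sq_le_sq' ?_ ?_
  · linarith [le_max_right r' s']
  · linarith [le_max_left r' s']

/-- Range-based safe pruning (RSP, Theorem 7): with
`a := Σ_{j:σ_j=1} (α₀)_j max(x_{a_j,k}, x_{b_j,k})²`,
`b := sqrt(Σ_j max(x_{a_j,k}, x_{b_j,k})⁴)` and
`λ′_a := λ₀(2εb + ‖α₀‖b + a)/(2λ₀ + ‖α₀‖b − a)`, for every `λ ∈ [λ′_a, λ₀]`,
every maximizer `α_λ*` of `D_λ` over the nonnegative orthant, and every
descendant `k′` of `k`, `(m_λ(α_λ*))_{k′} = 0`. -/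
theorem igml_range_safe_pruning {n p N : ℕ}
    (x : Fin n → Fin p → ℝ) (hx : ∀ i k, 0 ≤ x i k)
    (sgn : Fin N → ℝ) (hsgn : ∀ j, sgn j = 1 ∨ sgn j = -1)
    (a b : Fin N → Fin n) (t : Fin N → ℝ)
    (eta : ℝ) (heta : 0 < eta)
    (lam0 : ℝ) (hlam0 : 0 < lam0)
    (α0star : Fin N → ℝ) (hα0star_nonneg : ∀ j, 0 ≤ α0star j)
    (hα0star : IsMaxOn (dualObj (pairC x sgn a b) t lam0 eta) {α | ∀ j, 0 ≤ α j} α0star)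
    (α0 : Fin N → ℝ) (hα0_nonneg : ∀ j, 0 ≤ α0 j) (ε : ℝ)
    (hε : Real.sqrt (∑ j, (α0 j - α0star j) ^ 2) ≤ ε)
    (k : Fin p) :
    ∀ lam : ℝ, 0 < lam →
      lam0 * (2 * ε * Real.sqrt (∑ j, max (x (a j) k) (x (b j) k) ^ 4)
            + Real.sqrt (∑ j, α0 j ^ 2)
              * Real.sqrt (∑ j, max (x (a j) k) (x (b j) k) ^ 4)
            + ∑ j ∈ Finset.univ.filter (fun j => sgn j = 1),
                α0 j * max (x (a j) k) (x (b j) k) ^ 2)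
          / (2 * lam0 + Real.sqrt (∑ j, α0 j ^ 2)
              * Real.sqrt (∑ j, max (x (a j) k) (x (b j) k) ^ 4)
            - ∑ j ∈ Finset.univ.filter (fun j => sgn j = 1),
                α0 j * max (x (a j) k) (x (b j) k) ^ 2) ≤ lam →
      lam ≤ lam0 →
      ∀ αlamstar : Fin N → ℝ, (∀ j, 0 ≤ αlamstar j) →
        IsMaxOn (dualObj (pairC x sgn a b) t lam eta) {α | ∀ j, 0 ≤ α j} αlamstar →
        ∀ k' : Fin p, (∀ i, x i k' ≤ x i k) →
          mLam (pairC x sgn a b) lam eta αlamstar k' = 0 := by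
  intro lam hlam hbound hle α hα hmax k' hk'
  set q : Fin N → ℝ := fun j => max (x (a j) k) (x (b j) k) ^ 2 with hq
  set qD : Fin N → ℝ := fun j => if sgn j = 1 then q j else 0 with hqD
  have hq4 : ∑ j, max (x (a j) k) (x (b j) k) ^ 4 = ∑ j, q j ^ 2 :=
    sum_congr rfl fun j _ => by rw [hq]; ring
  have hqD_sum : ∑ j ∈ univ.filter (fun j => sgn j = 1), α0 j * max (x (a j) k) (x (b j) k) ^ 2
      = ∑ j, qD j * α0 j := by
    rw [sum_filter]
    refine sum_congr rfl fun j _ => ?_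
    simp only [hqD, hq]
    split_ifs <;> ring
  rw [hq4, hqD_sum] at hbound
  set B := Real.sqrt (∑ j, q j ^ 2)
  set A := ∑ j, qD j * α0 j
  have hqD_norm : Real.sqrt (∑ j, qD j ^ 2) ≤ B := by
    refine Real.sqrt_le_sqrt (sum_le_sum fun j _ => ?_)
    simp only [hqD]
    split_ifs
    · exact le_rfl
    · simpa using sq_nonneg (q j)
  have hnorm : ∀ β : Fin N → ℝ, ‖WithLp.toLp 2 β‖ = Real.sqrt (∑ j, β j ^ 2) := by
    intro β
    simp [EuclideanSpace.norm_eq]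
  set e0 : EuclideanSpace ℝ (Fin N) := WithLp.toLp 2 α0
  set e0s : EuclideanSpace ℝ (Fin N) := WithLp.toLp 2 α0star
  set e : EuclideanSpace ℝ (Fin N) := WithLp.toLp 2 α
  have hdist : ‖e0 - e0s‖ ≤ ε := by
    rw [← WithLp.toLp_sub, hnorm]
    exact hε
  rw [← hnorm α0] at hbound
  have hAB : A ≤ ‖e0‖ * B := by
    have h := sum_mul_le_of_norm_sub_smul_le qD e0 0 (c := 0) (R := ‖e0‖) (by simp)
    simp only [zero_mul, zero_add] at h
    exact h.trans (mul_le_mul_of_nonneg_left hqD_norm (norm_nonneg _))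
  rw [div_le_iff₀ (by linarith)] at hbound
  set c := (lam0 + lam) / (2 * lam0) with hc
  set d := (lam0 - lam) / (2 * lam0) with hd
  have hc0 : 0 ≤ c := by positivity
  have hd0 : 0 ≤ d := div_nonneg (by linarith) (by linarith)
  have hcd : c + d = 1 := by rw [hc, hd]; field_simp; ring
  have hsphere : ‖e - c • e0‖ ≤ d * ‖e0‖ + ε := by
    have h1 : ‖e - c • e0s‖ ≤ d * ‖e0s‖ :=
      norm_sub_smul_le_of_isMaxOn_dualObj hlam hle heta hα hα0star_nonneg hmax hα0star
    have h2 : ‖e0s‖ ≤ ‖e0‖ + ‖e0 - e0s‖ := norm_le_norm_add_norm_sub _ _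
    calc ‖e - c • e0‖ = ‖(e - c • e0s) - c • (e0 - e0s)‖ := by congr 1; module
      _ ≤ ‖e - c • e0s‖ + ‖c • (e0 - e0s)‖ := norm_sub_le _ _
      _ = ‖e - c • e0s‖ + c * ‖e0 - e0s‖ := by
        rw [norm_smul, Real.norm_of_nonneg hc0]
      _ ≤ d * (‖e0‖ + ‖e0 - e0s‖) + c * ‖e0 - e0s‖ := by
        linarith [mul_le_mul_of_nonneg_left h2 hd0]
      _ = d * ‖e0‖ + (c + d) * ‖e0 - e0s‖ := by ring
      _ ≤ d * ‖e0‖ + ε := by rw [hcd, one_mul]; linarith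
  have hterm : ∑ j, pairC x sgn a b k' j * α j ≤ ∑ j, qD j * α j := by
    refine sum_le_sum fun j _ => mul_le_mul_of_nonneg_right ?_ (hα j)
    rcases hsgn j with h | h
    · simp only [pairC, hqD, hq, h, if_true, one_mul]
      exact sq_sub_le_sq_max (hx _ _) (hx _ _) (hk' _) (hk' _)
    · simp only [pairC, hqD, h]
      rw [if_neg (by norm_num)]
      linarith [sq_nonneg (x (a j) k' - x (b j) k')]
  have hlin : ∑ j, qD j * α j ≤ c * A + (d * ‖e0‖ + ε) * B :=
    (sum_mul_le_of_norm_sub_smul_le qD e e0 hsphere).trans (by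
      have := mul_le_mul_of_nonneg_left hqD_norm ((norm_nonneg _).trans hsphere)
      linarith)
  have hfin : c * A + (d * ‖e0‖ + ε) * B ≤ lam := by
    have : c * A + (d * ‖e0‖ + ε) * B
        = ((lam0 + lam) * A + ((lam0 - lam) * ‖e0‖ + 2 * lam0 * ε) * B) / (2 * lam0) := by
      rw [hc, hd]; field_simp
    rw [this, div_le_iff₀ (by linarith)]
    linarith
  rw [mLam, max_eq_right (by linarith), mul_zero]
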